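/- Let (R, 𝔪, k) be a Noetherian local ring of prime characteristic p containing a coefficient field k, and let M be an Artinian R-module with an injective Frobenius action F. Then the stable part M_s is contained in the socle Soc(M). -/

import Mathlib

/-- The socle of a module `M` over a local ring `R`:
the set of elements killed by the maximal ideal. -/
def Socle (R M : Type*) [CommRing R] [IsLocalRing R] [AddCommGroup M] [Module R M] : Set M :=
  {x : M | ∀ r ∈ IsLocalRing.maximalIdeal R, r • x = 0}

/-- The `K`-span of a subset `S` of an `R`-module `M`, where `K` acts on `M` through a ring
homomorphism `ι : K →+* R` (e.g. the inclusion of a coefficient field): the set of finite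
`K`-linear combinations of elements of `S`. -/
def kSpan {K R M : Type*} [Field K] [CommRing R] [AddCommGroup M] [Module R M]
    (ι : K →+* R) (S : Set M) : Set M :=
  {m : M | ∃ (n : ℕ) (c : Fin n → K) (s : Fin n → M),
    (∀ i, s i ∈ S) ∧ m = ∑ i, ι (c i) • s i}

/-- The Hartshorne–Speiser stable part of a module `M` with Frobenius action `F`, relative to a
coefficient field `ι : K →+* R`: the intersection over `j ≥ 1` of the `K`-spans of the images
`F^j(M)`. -/
def stablePart {K R M : Type*} [Field K] [CommRing R] [AddCommGroup M] [Module R M]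
    (ι : K →+* R) (F : M → M) : Set M :=
  ⋂ j ∈ {j : ℕ | 1 ≤ j}, kSpan ι (Set.range F^[j])

open scoped TensorProduct

/-- A module all of whose elements are killed by powers of `x` is Artinian as soon as
the kernel of multiplication by `x` is. -/
theorem isArtinian_of_isArtinian_torsionBy {B P : Type*} [CommRing B] [AddCommGroup P]
    [Module B P] (x : B) (hx : ∀ y : P, ∃ n : ℕ, x ^ n • y = 0)
    [IsArtinian B (Submodule.torsionBy B P x)] : IsArtinian B P := by
  rw [← monotone_stabilizes_iff_artinian]
  intro g
  let f : ℕ → Submodule B P := g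
  have hf : ∀ {m n : ℕ}, m ≤ n → f n ≤ f m := fun h => g.monotone h
  let L : ℕ → Submodule B P → Submodule B (Submodule.torsionBy B P x) := fun i N =>
    (N.map (LinearMap.lsmul B P (x ^ i))).comap (Submodule.torsionBy B P x).subtype
  have mem_L : ∀ {i N t}, t ∈ L i N ↔ ∃ y ∈ N, x ^ i • y = (t : P) := fun {i N t} => Iff.rfl
  have L_mono : ∀ {i j N N'}, i ≤ j → N' ≤ N → L j N' ≤ L i N := by
    rintro i j N N' hij hN t ht
    obtain ⟨y, hy, hyt⟩ := mem_L.1 ht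
    refine mem_L.2 ⟨x ^ (j - i) • y, N.smul_mem _ (hN hy), ?_⟩
    rw [smul_smul, ← pow_add, Nat.add_sub_cancel' hij, hyt]
  obtain ⟨s, hs⟩ := IsArtinian.monotone_stabilizes
    (⟨fun j => L j (f j), fun i j h => L_mono h (hf h)⟩ :
      ℕ →o (Submodule B (Submodule.torsionBy B P x))ᵒᵈ)
  replace hs : ∀ m, s ≤ m → L s (f s) = L m (f m) := hs
  have hcol : ∀ i, ∃ n, ∀ m, n ≤ m → L i (f n) = L i (f m) := fun i =>
    IsArtinian.monotone_stabilizes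
      (⟨fun j => L i (f j), fun _ _ h => L_mono le_rfl (hf h)⟩ :
        ℕ →o (Submodule B (Submodule.torsionBy B P x))ᵒᵈ)
  choose n hn using hcol
  let N := max s ((Finset.range s).sup n)
  have hN : ∀ i m, N ≤ m → L i (f N) ≤ L i (f m) := by
    intro i m hm
    rcases lt_or_ge i s with hi | hi
    · have h1 : n i ≤ N :=
        (Finset.le_sup (f := n) (Finset.mem_range.2 hi)).trans (le_max_right _ _)
      rw [← hn i N h1, ← hn i m (h1.trans hm)]
    · calc L i (f N) ≤ L s (f s) := L_mono hi (hf (le_max_left _ _))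
        _ = L (max i m) (f (max i m)) := hs _ (hi.trans (le_max_left _ _))
        _ ≤ L i (f m) := L_mono (le_max_left _ _) (hf (le_max_right _ _))
  refine ⟨N, fun m hm => le_antisymm (α := Submodule B P) ?_ (hf hm)⟩
  have key : ∀ k : ℕ, ∀ y ∈ f N, x ^ k • y = 0 → y ∈ f m := by
    intro k
    induction k with
    | zero => intro y _ h; rw [pow_zero, one_smul] at h; rw [h]; exact Submodule.zero_mem _
    | succ k ih =>
      intro y hy h
      have ht : x ^ k • y ∈ Submodule.torsionBy B P x := by
        rw [Submodule.mem_torsionBy_iff, smul_smul, ← pow_succ', h]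
      obtain ⟨z, hz, hzy⟩ := mem_L.1 (hN k m hm (mem_L.2 ⟨y, hy, rfl⟩ : ⟨_, ht⟩ ∈ L k (f N)))
      have hd := ih (y - z) (Submodule.sub_mem _ hy (hf hm hz)) (by
        rw [smul_sub, hzy, sub_self])
      simpa using Submodule.add_mem _ hd hz
  intro y hy
  obtain ⟨k, hk⟩ := hx y
  exact key k y hy hk

/-- In an Artinian module over a local ring every element is killed by a power of any given
element of the maximal ideal. -/
theorem exists_pow_smul_eq_zero {R M : Type*} [CommRing R] [IsLocalRing R] [AddCommGroup M]
    [Module R M] [IsArtinian R M] {r : R} (hr : r ∈ IsLocalRing.maximalIdeal R) (x : M) :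
    ∃ n : ℕ, r ^ n • x = 0 := by
  obtain ⟨n, ⟨y, hy⟩, h⟩ := IsArtinian.exists_pow_succ_smul_dvd r
    (⟨x, Submodule.mem_span_singleton_self x⟩ : Submodule.span R {x})
  obtain ⟨a, rfl⟩ := Submodule.mem_span_singleton.1 hy
  replace h : r ^ n.succ • a • x = r ^ n • x := congrArg Subtype.val h
  have hu : IsUnit (1 - a * r) :=
    IsLocalRing.isUnit_one_sub_self_of_mem_nonunits _ (Ideal.mul_mem_left _ a hr)
  refine ⟨n, hu.smul_eq_zero.1 ?_⟩
  rw [sub_smul, one_smul, sub_eq_zero, smul_smul, mul_assoc, ← pow_succ', mul_comm, ← smul_smul, h]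

/-- By flatness, the kernel of multiplication by `x` is Artinian after base change if the base change
of the kernel is. -/
theorem isArtinian_baseChange_torsionBy {R B N : Type*} [CommRing R] [CommRing B] [Algebra R B]
    [Module.Flat R B] [AddCommGroup N] [Module R N] (x : R)
    [IsArtinian B (B ⊗[R] Submodule.torsionBy R N x)] :
    IsArtinian B (Submodule.torsionBy B (B ⊗[R] N) (algebraMap R B x)) := by
  have hex : Function.Exact (Submodule.torsionBy R N x).subtype (LinearMap.lsmul R N x) := by
    intro y; simp
  have hexB := Module.Flat.lTensor_exact B hex
  let g := (Submodule.torsionBy R N x).subtype.baseChange B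
  refine isArtinian_of_le (t := LinearMap.range g) fun z hz => ?_
  refine (hexB z).1 ?_
  rw [Submodule.mem_torsionBy_iff] at hz
  rw [← hz]
  have : (LinearMap.lsmul R N x).lTensor B = LinearMap.lsmul R (B ⊗[R] N) x := by
    ext; simp
  rw [this, algebraMap_smul]; rfl

/-- An Artinian module killed by the maximal ideal is finitely generated. -/
theorem finite_of_isArtinian_of_smul_eq_zero {R N : Type*} [CommRing R] [IsLocalRing R]
    [AddCommGroup N] [Module R N] [IsArtinian R N]
    (hN : ∀ r ∈ IsLocalRing.maximalIdeal R, ∀ y : N, r • y = 0) : Module.Finite R N := by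
  have hN' : Module.IsTorsionBySet R N (IsLocalRing.maximalIdeal R) := fun y r => hN r r.2 y
  let := hN'.module
  let _ : Field (R ⧸ IsLocalRing.maximalIdeal R) := Ideal.Quotient.field _
  have : IsSemisimpleModule R N := hN'.isSemisimpleModule_iff.1 inferInstance
  exact (IsSemisimpleModule.finite_tfae.out 0 2).2 ‹IsArtinian R N›

/-- A finite `B`-module killed by an ideal `I` such that a field surjects onto `B / I` is
Artinian. -/
theorem isArtinian_of_finite_of_smul_eq_zero {B P L : Type*} [CommRing B] [Field L]
    [AddCommGroup P] [Module B P] [Module.Finite B P] (φ : L →+* B) (I : Ideal B)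
    (hφ : ∀ b, ∃ l, b - φ l ∈ I) (hI : ∀ b ∈ I, ∀ y : P, b • y = 0) : IsArtinian B P := by
  have hP : Module.IsTorsionBySet B P I := fun y b => hI b b.2 y
  let := hP.module
  have hsurj : Function.Surjective ((Ideal.Quotient.mk I).comp φ) := by
    intro b
    obtain ⟨b, rfl⟩ := Ideal.Quotient.mk_surjective b
    obtain ⟨l, hl⟩ := hφ b
    exact ⟨l, (Ideal.Quotient.eq.2 hl).symm⟩
  have : IsArtinianRing (B ⧸ I) := hsurj.isArtinianRing
  have : IsScalarTower B (B ⧸ I) P := hP.isScalarTower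
  have : Module.Finite (B ⧸ I) P := Module.Finite.of_restrictScalars_finite B _ _
  have : IsArtinian (B ⧸ I) P := inferInstance
  exact isArtinian_of_surjective_algebraMap (R := B ⧸ I) Ideal.Quotient.mk_surjective

/-- Flat base change, trivial on residue fields up to a field `L ⊆ B`, preserves Artinian
modules over a Noetherian local ring. -/
theorem isArtinian_baseChange {R B L : Type*} {N : Type*} [CommRing R] [IsLocalRing R]
    [IsNoetherianRing R] [CommRing B] [Algebra R B] [Module.Flat R B] [Field L] (φ : L →+* B)
    (hφ : ∀ b, ∃ l, b - φ l ∈ (IsLocalRing.maximalIdeal R).map (algebraMap R B))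
    [AddCommGroup N] [Module R N] [IsArtinian R N] : IsArtinian B (B ⊗[R] N) := by
  have hpow : ∀ {N : Type _} [AddCommGroup N] [Module R N] [IsArtinian R N] (x : R)
      (hx : x ∈ IsLocalRing.maximalIdeal R) (z : B ⊗[R] N), ∃ n, algebraMap R B x ^ n • z = 0 := by
    intro N _ _ _ x hx z
    induction z using TensorProduct.induction_on with
    | zero => exact ⟨0, smul_zero _⟩
    | tmul b y =>
      obtain ⟨n, hn⟩ := exists_pow_smul_eq_zero hx y
      refine ⟨n, ?_⟩
      rw [← map_pow, algebraMap_smul, ← TensorProduct.tmul_smul, hn, TensorProduct.tmul_zero]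
    | add z w hz hw =>
      obtain ⟨m, hm⟩ := hz
      obtain ⟨n, hn⟩ := hw
      refine ⟨m + n, ?_⟩
      rw [smul_add, pow_add, mul_smul, mul_smul, hn, smul_zero, add_zero, smul_comm, hm, smul_zero]
  have key : ∀ s : Finset R, (s : Set R) ⊆ IsLocalRing.maximalIdeal R →
      (∀ (N' : Submodule R N), (∀ x ∈ s, ∀ y ∈ N', x • y = 0) → IsArtinian B (B ⊗[R] N')) →
      ∀ (N' : Submodule R N), IsArtinian B (B ⊗[R] N') := by
    classical
    intro s
    induction s using Finset.induction_on with
    | empty => intro _ H N'; exact H N' (by simp)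
    | insert x s _ ih =>
      intro hs H
      rw [Finset.coe_insert, Set.insert_subset_iff] at hs
      refine ih hs.2 fun N' hN' => ?_
      have h1 := H ((Submodule.torsionBy R N' x).map N'.subtype) (by
        rintro r hr _ ⟨y, hy, rfl⟩
        rcases Finset.mem_insert.1 hr with rfl | hr
        · rw [← map_smul, (Submodule.mem_torsionBy_iff _ _).1 hy, map_zero]
        · exact hN' r hr _ y.2)
      have h2 : IsArtinian B (B ⊗[R] Submodule.torsionBy R N' x) :=
        isArtinian_of_linearEquiv (((Submodule.equivMapOfInjective N'.subtype
          N'.injective_subtype (Submodule.torsionBy R N' x)).symm).baseChange R B _ _)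
      have h3 := isArtinian_baseChange_torsionBy (B := B) (N := N') x
      exact isArtinian_of_isArtinian_torsionBy (algebraMap R B x) (hpow x hs.1)
  obtain ⟨s, hs⟩ := IsNoetherian.noetherian (IsLocalRing.maximalIdeal R)
  have hsub : (s : Set R) ⊆ IsLocalRing.maximalIdeal R := hs ▸ Submodule.subset_span
  have htop := key s hsub (fun N' hN' => by
    have hm : ∀ r ∈ IsLocalRing.maximalIdeal R, ∀ y : N', r • y = 0 := by
      intro r hr y
      have hle : IsLocalRing.maximalIdeal R ≤ LinearMap.ker (LinearMap.toSpanSingleton R N' y) := by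
        rw [← hs, Submodule.span_le]
        exact fun x hx => Subtype.ext (hN' x hx y y.2)
      exact hle hr
    have := finite_of_isArtinian_of_smul_eq_zero hm
    refine isArtinian_of_finite_of_smul_eq_zero φ _ hφ fun b hb z => ?_
    have hle : (IsLocalRing.maximalIdeal R).map (algebraMap R B) ≤
        LinearMap.ker (LinearMap.toSpanSingleton B (B ⊗[R] N') z) := by
      rw [Ideal.map_le_iff_le_comap]
      intro r hr
      change algebraMap R B r • z = 0
      rw [algebraMap_smul]
      induction z using TensorProduct.induction_on with
      | zero => exact smul_zero _
      | tmul b y => rw [← TensorProduct.tmul_smul, hm r hr, TensorProduct.tmul_zero]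
      | add z w hz hw => rw [smul_add, hz, hw, add_zero]
    exact hle hb) ⊤
  exact isArtinian_of_linearEquiv (Submodule.topEquiv.baseChange R B _ N)

theorem iterate_smul_of_smul {B P : Type*} [CommRing B] [AddCommGroup P] [Module B P] {p : ℕ}
    {F : P → P} (hF : ∀ (b : B) z, F (b • z) = b ^ p • F z) (n : ℕ) (b : B) (z : P) :
    F^[n] (b • z) = b ^ p ^ n • F^[n] z := by
  induction n with
  | zero => simp
  | succ n ih => rw [Function.iterate_succ_apply', ih, hF, ← pow_mul, ← pow_succ,
      Function.iterate_succ_apply']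

/-- Elements of an Artinian module lying in a sufficiently deep image of Frobenius and killed by
a power of `r` are killed by `r`, up to nilpotents. -/
theorem exists_iterate_smul_eq_zero {B P : Type*} [CommRing B] [AddCommGroup P] [Module B P]
    [IsArtinian B P] {p : ℕ} (hp : 1 ≤ p) (F : P →+ P) (hF : ∀ (b : B) z, F (b • z) = b ^ p • F z)
    (r : B) : ∃ i, ∀ j z, r ^ p ^ j • F^[j + i] z = 0 → ∃ e, F^[e] (r • F^[j + i] z) = 0 := by
  let U : ℕ → Submodule B P := fun i =>
    { carrier := {z | ∃ e, F^[e] (r • F^[i] z) = 0}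
      zero_mem' := ⟨0, by simp [iterate_map_zero]⟩
      add_mem' := by
        rintro y z ⟨e, he⟩ ⟨e', he'⟩
        refine ⟨e + e', ?_⟩
        rw [iterate_map_add, smul_add, iterate_map_add, Function.iterate_add_apply _ _ _ (r • F^[i] z),
          he', add_comm e, Function.iterate_add_apply, he, iterate_map_zero, iterate_map_zero,
          add_zero]
      smul_mem' := by
        rintro b z ⟨e, he⟩
        refine ⟨e, ?_⟩
        rw [iterate_smul_of_smul hF i, smul_comm, iterate_smul_of_smul hF, he, smul_zero] }
  have hU : ∀ i, U (i + 1) ≤ U i := by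
    rintro i z ⟨e, he⟩
    refine ⟨e + 1, ?_⟩
    rw [Function.iterate_add_apply, Function.iterate_one, hF, ← Function.iterate_succ_apply' F,
      ← Nat.sub_add_cancel hp, pow_succ, mul_smul, iterate_smul_of_smul hF, he, smul_zero]
  obtain ⟨i, hi⟩ := IsArtinian.monotone_stabilizes
    (⟨U, antitone_nat_of_succ_le hU⟩ : ℕ →o (Submodule B P)ᵒᵈ)
  refine ⟨i, fun j z hz => ?_⟩
  have hzi : z ∈ U i := ⟨j, by
    rw [iterate_smul_of_smul hF, ← Function.iterate_add_apply, hz]⟩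
  have h : U i = U (j + i) := hi (j + i) (Nat.le_add_left _ _)
  exact (h ▸ hzi : z ∈ U (j + i))

/-- The extension of a Frobenius action along a ring map. -/
noncomputable def frobeniusBaseChange {R M : Type*} (B : Type*) [CommRing R] [AddCommGroup M]
    [Module R M] [CommRing B] [Algebra R B] (p : ℕ) [ExpChar B p] (F : M →+ M)
    (hF : ∀ (r : R) m, F (r • m) = r ^ p • F m) : B ⊗[R] M →+ B ⊗[R] M :=
  TensorProduct.liftAddHom
    (AddMonoidHom.mk' (fun b => (TensorProduct.mk R B M (b ^ p)).toAddMonoidHom.comp F)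
      fun b c => by ext m; simp [add_pow_expChar])
    fun r b m => by simp [hF, smul_pow]

section frobeniusBaseChange

variable {R M B : Type*} [CommRing R] [AddCommGroup M] [Module R M] [CommRing B] [Algebra R B]
  {p : ℕ} [ExpChar B p] {F : M →+ M} (hF : ∀ (r : R) m, F (r • m) = r ^ p • F m)

theorem frobeniusBaseChange_tmul (b : B) (m : M) :
    frobeniusBaseChange B p F hF (b ⊗ₜ m) = (b ^ p) ⊗ₜ F m := rfl

theorem frobeniusBaseChange_smul (b : B) (z : B ⊗[R] M) :
    frobeniusBaseChange B p F hF (b • z) = b ^ p • frobeniusBaseChange B p F hF z := by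
  induction z using TensorProduct.induction_on with
  | zero => simp
  | tmul c m => simp [frobeniusBaseChange_tmul, TensorProduct.smul_tmul', mul_pow]
  | add z w hz hw => simp [hz, hw]

theorem frobeniusBaseChange_iterate_tmul (n : ℕ) (b : B) (m : M) :
    (frobeniusBaseChange B p F hF)^[n] (b ⊗ₜ m) = (b ^ p ^ n) ⊗ₜ F^[n] m := by
  induction n with
  | zero => simp
  | succ n ih => rw [Function.iterate_succ_apply', ih, frobeniusBaseChange_tmul, ← pow_mul,
      ← pow_succ, Function.iterate_succ_apply']

end frobeniusBaseChange

/-- Let `(R, 𝔪, k)` be a Noetherian local ring of prime characteristic `p` containing a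
coefficient field `k` (given by `ι : k →+* R` inducing an isomorphism onto the residue field),
and let `M` be an Artinian `R`-module with an injective Frobenius action `F`.  Then the stable
part `M_s` is contained in the socle of `M`. -/
theorem stablePart_subset_socle
    {K R M : Type*} [Field K] [CommRing R] [IsLocalRing R] [IsNoetherianRing R]
    (p : ℕ) [Fact p.Prime] [CharP R p]
    (ι : K →+* R) (hcoeff : Function.Bijective ((IsLocalRing.residue R).comp ι))
    [AddCommGroup M] [Module R M] [IsArtinian R M]
    (F : M → M)
    (hadd : ∀ x y : M, F (x + y) = F x + F y)
    (hsmul : ∀ (r : R) (m : M), F (r • m) = r ^ p • F m)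
    (hinj : Function.Injective F) :
    stablePart ι F ⊆ Socle R M := by
  let _ : Algebra K R := ι.toAlgebra
  have hιK : Function.Injective (algebraMap K R) := ι.injective
  have : CharP K p := (CharP.charP_iff_prime_eq_zero Fact.out).2 (hιK (by simp))
  let L := AlgebraicClosure K
  let B := R ⊗[K] L
  let φ : L →+* B := (Algebra.TensorProduct.includeRight : L →ₐ[K] B).toRingHom
  have hRB : Function.Injective (algebraMap R B) := FaithfulSMul.algebraMap_injective R B
  have : CharP B p := charP_of_injective_algebraMap hRB p
  have hφ : ∀ b : B, ∃ l, b - φ l ∈ (IsLocalRing.maximalIdeal R).map (algebraMap R B) := by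
    intro b
    induction b using TensorProduct.induction_on with
    | zero => exact ⟨0, by simp⟩
    | tmul r l =>
      obtain ⟨k, hk⟩ := hcoeff.2 (IsLocalRing.residue R r)
      have hm : r - ι k ∈ IsLocalRing.maximalIdeal R := by
        rw [← IsLocalRing.residue_eq_zero_iff, map_sub, sub_eq_zero]
        exact hk.symm
      refine ⟨k • l, ?_⟩
      have : (r ⊗ₜ[K] l : B) - φ (k • l) = algebraMap R B (r - ι k) * (1 ⊗ₜ l) := by
        have h1 : φ (k • l) = (ι k) ⊗ₜ[K] l := by
          change (1 : R) ⊗ₜ[K] (k • l) = _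
          rw [← TensorProduct.smul_tmul, Algebra.smul_def, mul_one]; rfl
        rw [h1, ← TensorProduct.sub_tmul, Algebra.TensorProduct.algebraMap_apply,
          Algebra.TensorProduct.tmul_mul_tmul, mul_one, one_mul]; rfl
      rw [this]
      exact Ideal.mul_mem_right _ _ (Ideal.mem_map_of_mem _ hm)
    | add b c hb hc =>
      obtain ⟨l, hl⟩ := hb
      obtain ⟨l', hl'⟩ := hc
      exact ⟨l + l', by rw [map_add, add_sub_add_comm]; exact add_mem hl hl'⟩
  have : IsArtinian B (B ⊗[R] M) := isArtinian_baseChange φ hφ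
  let G : M →+ M := AddMonoidHom.mk' F hadd
  let FB := frobeniusBaseChange B p G hsmul
  have hFB : ∀ (n : ℕ) (b : B) (m : M), FB^[n] (b ⊗ₜ m) = (b ^ p ^ n) ⊗ₜ F^[n] m :=
    frobeniusBaseChange_iterate_tmul hsmul
  intro x hx r hr
  obtain ⟨i, hi⟩ := exists_iterate_smul_eq_zero (Fact.out : p.Prime).one_le FB
    (frobeniusBaseChange_smul hsmul) (algebraMap R B r)
  obtain ⟨n, hn⟩ := exists_pow_smul_eq_zero hr x
  have hx' : x ∈ kSpan ι (Set.range F^[n + 1 + i]) := by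
    refine Set.mem_iInter₂.1 hx (n + 1 + i) ?_
    change 1 ≤ n + 1 + i
    omega
  obtain ⟨t, c, s, hs, hxs⟩ := hx'
  choose y hy using hs
  choose d hd using fun a => IsAlgClosed.exists_pow_nat_eq (algebraMap K L (c a))
    (pow_pos (Fact.out : p.Prime).pos (n + 1 + i))
  have hz : FB^[n + 1 + i] (∑ a, φ (d a) ⊗ₜ[R] y a) = 1 ⊗ₜ[R] x := by
    have hsum : FB^[n + 1 + i] (∑ a, φ (d a) ⊗ₜ[R] y a) =
        ∑ a, FB^[n + 1 + i] (φ (d a) ⊗ₜ[R] y a) :=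
      map_sum (AddMonoidHom.mk' FB^[n + 1 + i] (iterate_map_add FB _)) _ _
    rw [hsum, hxs, TensorProduct.tmul_sum]
    refine Finset.sum_congr rfl fun a _ => ?_
    rw [hFB, ← map_pow, hd, TensorProduct.tmul_smul,
      TensorProduct.smul_tmul', ← hy a]
    congr 1
    rw [Algebra.smul_def, mul_one]
    change (Algebra.TensorProduct.includeRight : L →ₐ[K] B) (algebraMap K L (c a)) = _
    rw [AlgHom.commutes, IsScalarTower.algebraMap_apply K R B]; rfl
  have hle : n ≤ p ^ (n + 1) :=
    (Nat.le_succ n).trans (Nat.lt_pow_self (Fact.out : p.Prime).one_lt).le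
  obtain ⟨e, he⟩ := hi (n + 1) (∑ a, φ (d a) ⊗ₜ[R] y a) (by
    rw [hz, ← map_pow, algebraMap_smul, ← TensorProduct.tmul_smul,
      ← Nat.sub_add_cancel hle, pow_add, mul_smul, hn, smul_zero, TensorProduct.tmul_zero])
  rw [hz, algebraMap_smul, ← TensorProduct.tmul_smul, hFB, one_pow] at he
  have hzero : F^[e] (r • x) = F^[e] 0 := by
    have h0 : F^[e] 0 = 0 := iterate_map_zero G e
    rw [h0]
    refine Module.FaithfullyFlat.tensorProduct_mk_injective (A := R) (B := B) M ?_
    rw [map_zero]; exact he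
  exact hinj.iterate e hzero
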